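/- Fix c₀ > 0, 0 < s' < 1/2 and T > 0. There exists C > 0, independent of δ ∈ (0,1) and t ∈ [0,T], such that for every Schwartz function f on ℝ: |((∂_t G_δ)(t,D) f, G_δ(t,D) f)_{L²(ℝ)}| ≤ C ‖G_δ(t,D) f‖²_{H^{s'}(ℝ)}, and |(v (∂_t G_δ)(t,D) f, v G_δ(t,D) f)_{L²(ℝ)}| ≤ C ‖G_δ(t,D) f‖²_{H^{s'}₁(ℝ)}, where (∂_t G_δ)(t,D) is the Fourier multiplier with symbol ∂_t G_δ(t,ξ) and (v u)(v) = v·u(v). -/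

import Mathlib

open MeasureTheory Real

noncomputable section

/-- Japanese bracket `⟨v⟩ = (1+v²)^{1/2}`. -/
def jap (v : ℝ) : ℝ := Real.sqrt (1 + v ^ 2)

/-- Fourier transform on `ℝ`: `𝓕u(ξ) = ∫ e^{-2πivξ} u(v) dv`. -/
def FT (u : ℝ → ℂ) (ξ : ℝ) : ℂ :=
  ∫ v : ℝ, Complex.exp (-(2 * Real.pi * v * ξ) * Complex.I) * u v

/-- Inverse Fourier transform on `ℝ`. -/
def IFT (U : ℝ → ℂ) (v : ℝ) : ℂ :=
  ∫ ξ : ℝ, Complex.exp ((2 * Real.pi * v * ξ) * Complex.I) * U ξ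

/-- Fourier multiplier `a(D)` with symbol `a`. -/
def mult (a : ℝ → ℝ) (u : ℝ → ℂ) : ℝ → ℂ :=
  IFT fun ξ => (a ξ : ℂ) * FT u ξ

/-- The exponential mollifier `G_δ(t,ξ) = e^{c₀t⟨ξ⟩^{2s'}}/(1+δe^{c₀t⟨ξ⟩^{2s'}})`. -/
def Gmol (c₀ s' δ t ξ : ℝ) : ℝ :=
  Real.exp (c₀ * t * jap ξ ^ (2 * s')) / (1 + δ * Real.exp (c₀ * t * jap ξ ^ (2 * s')))

/-- `L²` hermitian inner product `(a,b) = ∫ a b̄`. -/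
def L2inner (a b : ℝ → ℂ) : ℂ := ∫ v : ℝ, a v * (starRingEnd ℂ) (b v)

/-- `H^σ(ℝ)` norm. -/
def HsNorm (σ : ℝ) (u : ℝ → ℂ) : ℝ :=
  (∫ ξ : ℝ, jap ξ ^ (2 * σ) * ‖FT u ξ‖ ^ 2) ^ (1 / 2 : ℝ)

/-- Weighted Sobolev `H^σ_ℓ(ℝ)` norm, `‖u‖ = ‖⟨v⟩^ℓ u‖_{H^σ}`. -/
def HswNorm (σ ℓ : ℝ) (u : ℝ → ℂ) : ℝ :=
  HsNorm σ fun v => (jap v ^ ℓ : ℝ) * u v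


open scoped FourierTransform SchwartzMap ContDiff

theorem jap_pos (v : ℝ) : 0 < jap v := Real.sqrt_pos.2 (by positivity)

theorem jap_sq (v : ℝ) : jap v ^ 2 = 1 + v ^ 2 := Real.sq_sqrt (by positivity)

theorem one_le_jap (v : ℝ) : 1 ≤ jap v := Real.one_le_sqrt.2 (by nlinarith [sq_nonneg v])

theorem abs_le_jap (v : ℝ) : |v| ≤ jap v := Real.abs_le_sqrt (by linarith)

theorem jap_le_one_add_abs (v : ℝ) : jap v ≤ 1 + |v| := by
  refine Real.sqrt_le_iff.2 ⟨by positivity, ?_⟩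
  nlinarith [sq_abs v, abs_nonneg v]

theorem jap_rpow_eq (r v : ℝ) : jap v ^ r = (1 + ‖v‖ ^ 2) ^ (r / 2) := by
  rw [jap, Real.sqrt_eq_rpow, ← Real.rpow_mul (by positivity), Real.norm_eq_abs, sq_abs]
  ring_nf

theorem hasTemperateGrowth_jap_rpow (r : ℝ) :
    (fun v : ℝ => jap v ^ r).HasTemperateGrowth := by
  simp_rw [jap_rpow_eq]
  exact Function.hasTemperateGrowth_one_add_norm_sq_rpow ℝ (r / 2)

theorem one_le_jap_rpow {r : ℝ} (hr : 0 ≤ r) (v : ℝ) : 1 ≤ jap v ^ r :=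
  Real.one_le_rpow (one_le_jap v) hr

theorem abs_jap_sub_jap_le (x y : ℝ) : |jap x - jap y| ≤ |x - y| := by
  have hx := abs_le_jap x
  have hy := abs_le_jap y
  have hs : 0 < jap x + jap y := add_pos (jap_pos x) (jap_pos y)
  refine le_of_mul_le_mul_right ?_ hs
  calc |jap x - jap y| * (jap x + jap y) = |(jap x - jap y) * (jap x + jap y)| := by
        rw [abs_mul, abs_of_pos hs]
    _ = |x - y| * |x + y| := by
        rw [← abs_mul]
        congr 1
        linear_combination jap_sq x - jap_sq y
    _ ≤ |x - y| * (jap x + jap y) := by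
        gcongr
        exact (abs_add_le x y).trans (add_le_add hx hy)

theorem abs_inv_jap_le_one (x : ℝ) : |(jap x)⁻¹| ≤ 1 := by
  rw [abs_inv, abs_of_pos (jap_pos x)]
  exact inv_le_one_of_one_le₀ (one_le_jap x)

theorem abs_div_jap_le_one (x : ℝ) : |x / jap x| ≤ 1 := by
  rw [abs_div, abs_of_pos (jap_pos x)]
  exact div_le_one_of_le₀ (abs_le_jap x) (jap_pos x).le

theorem abs_inv_jap_sub_le (x y : ℝ) : |(jap x)⁻¹ - (jap y)⁻¹| ≤ |x - y| := by
  have hx := (jap_pos x).ne'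
  have hy := (jap_pos y).ne'
  have h : (jap x)⁻¹ - (jap y)⁻¹ = (jap x)⁻¹ * (jap y)⁻¹ * (jap y - jap x) := by field_simp
  rw [h, abs_mul, abs_mul, abs_sub_comm]
  have h1 : |(jap x)⁻¹| * |(jap y)⁻¹| ≤ 1 :=
    mul_le_one₀ (abs_inv_jap_le_one x) (abs_nonneg _) (abs_inv_jap_le_one y)
  calc _ ≤ 1 * |x - y| :=
        mul_le_mul h1 (abs_jap_sub_jap_le x y) (abs_nonneg _) zero_le_one
    _ = _ := one_mul _

theorem abs_div_jap_sub_le (x y : ℝ) : |x / jap x - y / jap y| ≤ 2 * |x - y| := by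
  have hx := (jap_pos x).ne'
  have hy := (jap_pos y).ne'
  have h : x / jap x - y / jap y
      = (jap x)⁻¹ * (x - y) + (jap x)⁻¹ * (y / jap y) * (jap y - jap x) := by
    field_simp
    ring
  have h1 : |(jap x)⁻¹| * |y / jap y| ≤ 1 :=
    mul_le_one₀ (abs_inv_jap_le_one x) (abs_nonneg _) (abs_div_jap_le_one y)
  calc |x / jap x - y / jap y|
      ≤ |(jap x)⁻¹ * (x - y)| + |(jap x)⁻¹ * (y / jap y) * (jap y - jap x)| := by
        rw [h]
        exact abs_add_le _ _
    _ ≤ 1 * |x - y| + 1 * |x - y| := by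
        rw [abs_mul, abs_mul (_ * _), abs_mul (jap x)⁻¹, abs_sub_comm (jap y)]
        exact add_le_add
          (mul_le_mul_of_nonneg_right (abs_inv_jap_le_one x) (abs_nonneg _))
          (mul_le_mul h1 (abs_jap_sub_jap_le x y) (abs_nonneg _) zero_le_one)
    _ = 2 * |x - y| := by ring

/-! ### Temperate growth of the sigmoid function -/

theorem exists_polynomial_iteratedDeriv_sigmoid (n : ℕ) :
    ∃ p : Polynomial ℝ, iteratedDeriv n Real.sigmoid = fun x => p.eval (Real.sigmoid x) := by
  induction n with
  | zero => exact ⟨Polynomial.X, by simp⟩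
  | succ n ih =>
    obtain ⟨p, hp⟩ := ih
    refine ⟨p.derivative * (Polynomial.X * (1 - Polynomial.X)), ?_⟩
    rw [iteratedDeriv_succ, hp]
    ext x
    simpa [Function.comp_def] using ((p.hasDerivAt _).comp x (Real.hasDerivAt_sigmoid x)).deriv

theorem hasTemperateGrowth_sigmoid : Real.sigmoid.HasTemperateGrowth := by
  refine ⟨contDiff_sigmoid.of_le (by simp), fun n => ?_⟩
  obtain ⟨p, hp⟩ := exists_polynomial_iteratedDeriv_sigmoid n
  obtain ⟨C, hC⟩ := (isCompact_Icc (a := (0 : ℝ)) (b := 1)).exists_bound_of_continuousOn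
    p.continuous.continuousOn
  refine ⟨0, C, fun x => ?_⟩
  rw [norm_iteratedFDeriv_eq_norm_iteratedDeriv, hp, pow_zero, mul_one]
  exact hC _ ⟨Real.sigmoid_nonneg x, Real.sigmoid_le_one x⟩

theorem Gmol_eq_sigmoid {δ : ℝ} (hδ : 0 < δ) (c₀ s' t ξ : ℝ) :
    Gmol c₀ s' δ t ξ = δ⁻¹ * Real.sigmoid (c₀ * t * jap ξ ^ (2 * s') + Real.log δ) := by
  rw [Real.sigmoid_def, neg_add, Real.exp_add, Real.exp_neg, Real.exp_neg, Real.exp_log hδ, Gmol]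
  have := Real.exp_pos (c₀ * t * jap ξ ^ (2 * s'))
  field_simp
  ring

/-- The symbol `c₀⟨ξ⟩^{2s'} / (1 + δ e^{c₀t⟨ξ⟩^{2s'}})`, which is the quotient of `∂_t G_δ` by
`G_δ`. -/
def logDerivGmol (c₀ s' δ t ξ : ℝ) : ℝ :=
  c₀ * jap ξ ^ (2 * s') *
    (1 - Real.sigmoid (c₀ * t * jap ξ ^ (2 * s') + Real.log δ))

theorem deriv_Gmol {δ : ℝ} (hδ : 0 < δ) (c₀ s' t ξ : ℝ) :
    deriv (fun τ => Gmol c₀ s' δ τ ξ) t = logDerivGmol c₀ s' δ t ξ * Gmol c₀ s' δ t ξ := by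
  simp_rw [Gmol_eq_sigmoid hδ]
  have h1 : HasDerivAt (fun τ : ℝ => c₀ * τ * jap ξ ^ (2 * s') + Real.log δ)
      (c₀ * jap ξ ^ (2 * s')) t := by
    simpa using (((hasDerivAt_id t).const_mul c₀).mul_const (jap ξ ^ (2 * s'))).add_const
      (Real.log δ)
  have h2 := (((Real.hasDerivAt_sigmoid (c₀ * t * jap ξ ^ (2 * s') + Real.log δ)).comp t
    h1).const_mul δ⁻¹).deriv
  simp only [Function.comp_def] at h2
  rw [h2, logDerivGmol]
  ring

theorem hasTemperateGrowth_sigmoid_jap (c₀ s' t l : ℝ) :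
    (fun ξ => Real.sigmoid (c₀ * t * jap ξ ^ (2 * s') + l)).HasTemperateGrowth := by
  have h := hasTemperateGrowth_jap_rpow (2 * s')
  exact hasTemperateGrowth_sigmoid.comp (f := fun ξ => c₀ * t * jap ξ ^ (2 * s') + l)
    (by fun_prop)

theorem hasTemperateGrowth_Gmol {δ : ℝ} (hδ : 0 < δ) (c₀ s' t : ℝ) :
    (Gmol c₀ s' δ t).HasTemperateGrowth := by
  have h : Gmol c₀ s' δ t = _ := funext fun ξ => Gmol_eq_sigmoid hδ c₀ s' t ξ
  rw [h]
  exact (Function.HasTemperateGrowth.const _).mul (hasTemperateGrowth_sigmoid_jap _ _ _ _)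

theorem hasTemperateGrowth_logDerivGmol (c₀ s' δ t : ℝ) :
    (logDerivGmol c₀ s' δ t).HasTemperateGrowth :=
  ((Function.HasTemperateGrowth.const _).mul (hasTemperateGrowth_jap_rpow _)).mul
    ((Function.HasTemperateGrowth.const _).sub (hasTemperateGrowth_sigmoid_jap _ _ _ _))

theorem abs_logDerivGmol_le {c₀ : ℝ} (hc₀ : 0 < c₀) (s' δ t ξ : ℝ) :
    |logDerivGmol c₀ s' δ t ξ| ≤ c₀ * jap ξ ^ (2 * s') := by
  have h0 : 0 ≤ c₀ * jap ξ ^ (2 * s') := mul_nonneg hc₀.le (Real.rpow_nonneg (jap_pos ξ).le _)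
  rw [logDerivGmol, abs_mul, abs_of_nonneg h0]
  refine mul_le_of_le_one_right h0 (abs_le.2 ⟨?_, ?_⟩)
  · linarith [Real.sigmoid_le_one (c₀ * t * jap ξ ^ (2 * s') + Real.log δ)]
  · linarith [Real.sigmoid_nonneg (c₀ * t * jap ξ ^ (2 * s') + Real.log δ)]

theorem hasDerivAt_jap (ξ : ℝ) : HasDerivAt jap (ξ / jap ξ) ξ := by
  have h : HasDerivAt (fun v : ℝ => 1 + v ^ 2) (2 * ξ) ξ := by
    simpa using (hasDerivAt_pow 2 ξ).const_add 1
  have h' := h.sqrt (by positivity)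
  rwa [mul_div_mul_left _ _ two_ne_zero] at h'

/-- For `s' ≤ 1/2` the `ξ`-derivative of `logDerivGmol` is bounded by its leading factor
`⟨ξ⟩^{2s'}`, uniformly in `δ` and in bounded `t`. -/
theorem abs_deriv_logDerivGmol_le {c₀ s' T t : ℝ} (hc₀ : 0 < c₀) (hs'0 : 0 < s')
    (hs' : s' < 1 / 2) (ht0 : 0 ≤ t) (htT : t ≤ T) (δ ξ : ℝ) :
    |deriv (logDerivGmol c₀ s' δ t) ξ| ≤ c₀ * (1 + c₀ * T) * jap ξ ^ (2 * s') := by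
  set φ := jap ξ ^ (2 * s') with hφ
  set S := Real.sigmoid (c₀ * t * φ + Real.log δ) with hS
  have hφ1 : 1 ≤ φ := one_le_jap_rpow (by linarith) ξ
  obtain ⟨φ', hderiv, hφ'1, hφφ'⟩ : ∃ φ', HasDerivAt (fun v => jap v ^ (2 * s')) φ' ξ ∧
      |φ'| ≤ 1 ∧ φ * |φ'| ≤ φ := by
    have hj1 := one_le_jap ξ
    have hle : |ξ / jap ξ * (2 * s') * jap ξ ^ (2 * s' - 1)| ≤ 1 := by
      rw [abs_mul, abs_mul, abs_of_nonneg (by linarith : 0 ≤ 2 * s'),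
        abs_of_nonneg (Real.rpow_nonneg (jap_pos ξ).le _)]
      have h1 := abs_div_jap_le_one ξ
      have h2 : jap ξ ^ (2 * s' - 1) ≤ 1 :=
        Real.rpow_le_one_of_one_le_of_nonpos hj1 (by linarith)
      refine mul_le_one₀ (mul_le_one₀ h1 (by linarith) (by linarith))
        (Real.rpow_nonneg (jap_pos ξ).le _) h2
    exact ⟨_, (hasDerivAt_jap ξ).rpow_const (Or.inl (jap_pos ξ).ne'), hle,
      mul_le_of_le_one_right (by linarith) hle⟩
  have hS0 : 0 ≤ S := Real.sigmoid_nonneg _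
  have hS1 : S ≤ 1 := Real.sigmoid_le_one _
  have hSderiv : HasDerivAt (fun v => Real.sigmoid (c₀ * t * jap v ^ (2 * s') + Real.log δ))
      (S * (1 - S) * (c₀ * t * φ')) ξ :=
    (Real.hasDerivAt_sigmoid _).comp ξ ((hderiv.const_mul (c₀ * t)).add_const _)
  have hd : deriv (logDerivGmol c₀ s' δ t) ξ =
      c₀ * φ' * (1 - S) + c₀ * φ * (-(S * (1 - S) * (c₀ * t * φ'))) :=
    ((hderiv.const_mul c₀).mul (hSderiv.const_sub 1)).deriv
  have hT : 0 ≤ T := ht0.trans htT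
  have h1S : |1 - S| ≤ 1 := abs_le.2 ⟨by linarith, by linarith⟩
  have hSS : |S| ≤ 1 := abs_le.2 ⟨by linarith, by linarith⟩
  calc |deriv (logDerivGmol c₀ s' δ t) ξ|
      ≤ |c₀ * φ' * (1 - S)| + |c₀ * φ * (-(S * (1 - S) * (c₀ * t * φ')))| := by
        rw [hd]
        exact abs_add_le _ _
    _ = c₀ * (|φ'| * |1 - S|) + c₀ * (c₀ * (t * ((|S| * |1 - S|) * (φ * |φ'|)))) := by
        simp only [abs_mul, abs_neg, abs_of_pos hc₀, abs_of_nonneg ht0,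
          abs_of_pos (zero_lt_one.trans_le hφ1)]
        ring
    _ ≤ c₀ * (1 * 1) + c₀ * (c₀ * (T * ((1 * 1) * φ))) := by gcongr
    _ ≤ c₀ * (1 + c₀ * T) * φ := by
        nlinarith [mul_nonneg (mul_nonneg hc₀.le hc₀.le) hT]

/-! ### Weighted integrals of Schwartz functions -/

theorem integrable_norm_mul_norm (u w : 𝓢(ℝ, ℂ)) : Integrable fun x => ‖u x‖ * ‖w x‖ :=
  (u.memLp 2).norm.integrable_mul (w.memLp 2).norm

theorem integrable_norm_sq (u : 𝓢(ℝ, ℂ)) : Integrable fun x => ‖u x‖ ^ 2 := by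
  simpa only [sq] using integrable_norm_mul_norm u u

theorem integrable_jap_rpow_mul_norm_sq (r : ℝ) (u : 𝓢(ℝ, ℂ)) :
    Integrable fun x => jap x ^ r * ‖u x‖ ^ 2 := by
  refine (integrable_norm_mul_norm
    (SchwartzMap.smulLeftCLM ℂ (fun v : ℝ => jap v ^ r) u) u).congr (.of_forall fun x => ?_)
  simp only [SchwartzMap.smulLeftCLM_apply_apply (hasTemperateGrowth_jap_rpow r), norm_smul,
    Real.norm_eq_abs, abs_of_nonneg (Real.rpow_nonneg (jap_pos x).le r)]
  ring

theorem abs_rpow_le_jap_rpow {r : ℝ} (hr : 0 ≤ r) (x : ℝ) : |x| ^ r ≤ jap x ^ r :=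
  Real.rpow_le_rpow (abs_nonneg x) (abs_le_jap x) hr

theorem integrable_abs_rpow_mul_norm_sq {r : ℝ} (hr : 0 ≤ r) (u : 𝓢(ℝ, ℂ)) :
    Integrable fun x => |x| ^ r * ‖u x‖ ^ 2 := by
  refine (integrable_jap_rpow_mul_norm_sq r u).mono'
    (((continuous_abs.rpow_const fun _ => Or.inr hr).mul
      (u.continuous.norm.pow 2)).aestronglyMeasurable) (.of_forall fun x => ?_)
  rw [Real.norm_of_nonneg (by positivity)]
  exact mul_le_mul_of_nonneg_right (abs_rpow_le_jap_rpow hr x) (by positivity)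

theorem jap_rpow_le_one_add_abs_rpow {r : ℝ} (hr0 : 0 ≤ r) (hr : r ≤ 1) (x : ℝ) :
    jap x ^ r ≤ 1 + |x| ^ r := by
  calc jap x ^ r ≤ (1 + |x|) ^ r :=
        Real.rpow_le_rpow (jap_pos x).le (jap_le_one_add_abs x) hr0
    _ ≤ 1 ^ r + |x| ^ r := Real.rpow_add_le_add_rpow zero_le_one (abs_nonneg x) hr0 hr
    _ = 1 + |x| ^ r := by rw [Real.one_rpow]

/-! ### The Gagliardo seminorm of a Schwartz function -/

theorem integrableOn_min_mul_rpow {s : ℝ} (hs0 : 0 < s) (hs : s < 1) (A : ℝ) (hA : 0 ≤ A) :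
    IntegrableOn (fun h : ℝ => min 4 (A * h ^ 2) * h ^ (-1 - 2 * s)) (Set.Ioi 0) := by
  have hmeas : Measurable fun h : ℝ => min 4 (A * h ^ 2) * h ^ (-1 - 2 * s) := by fun_prop
  rw [← Set.Ioc_union_Ioi_eq_Ioi zero_le_one]
  refine IntegrableOn.union ?_ ?_
  · have h1 : IntegrableOn (fun h : ℝ => A * h ^ (1 - 2 * s)) (Set.Ioc 0 1) :=
      ((intervalIntegrable_iff_integrableOn_Ioc_of_le zero_le_one).1
        (intervalIntegral.intervalIntegrable_rpow' (by linarith))).const_mul A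
    refine h1.mono' hmeas.aestronglyMeasurable
      ((ae_restrict_iff' measurableSet_Ioc).2 (.of_forall fun h hh => ?_))
    have h0 : 0 < h := hh.1
    rw [Real.norm_of_nonneg (by positivity)]
    calc min 4 (A * h ^ 2) * h ^ (-1 - 2 * s) ≤ A * h ^ 2 * h ^ (-1 - 2 * s) := by
          gcongr
          exact min_le_right _ _
      _ = A * h ^ (1 - 2 * s) := by
          rw [mul_assoc, ← Real.rpow_natCast h 2, ← Real.rpow_add h0]
          norm_num
          ring_nf
          simp
  · have h1 : IntegrableOn (fun h : ℝ => 4 * h ^ (-1 - 2 * s)) (Set.Ioi 1) :=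
      (integrableOn_Ioi_rpow_of_lt (by linarith) zero_lt_one).const_mul 4
    refine h1.mono' hmeas.aestronglyMeasurable
      ((ae_restrict_iff' measurableSet_Ioi).2 (.of_forall fun h hh => ?_))
    have h0 : 0 < h := zero_lt_one.trans hh
    rw [Real.norm_of_nonneg (by positivity)]
    gcongr
    exact min_le_left _ _

/-- The constant relating the Gagliardo seminorm to the homogeneous Sobolev seminorm. -/
def gagliardoConst (s : ℝ) : ℝ :=
  ∫ h in Set.Ioi (0 : ℝ), (2 * Real.sin (π * h)) ^ 2 * h ^ (-1 - 2 * s)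

theorem integrableOn_sin_sq_mul_rpow {s : ℝ} (hs0 : 0 < s) (hs : s < 1) :
    IntegrableOn (fun h : ℝ => (2 * Real.sin (π * h)) ^ 2 * h ^ (-1 - 2 * s)) (Set.Ioi 0) := by
  have hmeas : Measurable fun h : ℝ => (2 * Real.sin (π * h)) ^ 2 * h ^ (-1 - 2 * s) := by
    fun_prop
  refine (integrableOn_min_mul_rpow hs0 hs (4 * π ^ 2) (by positivity)).mono'
    hmeas.aestronglyMeasurable
    ((ae_restrict_iff' measurableSet_Ioi).2 (.of_forall fun h hh => ?_))
  have h0 : 0 < h := hh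
  rw [Real.norm_of_nonneg (by positivity)]
  gcongr
  refine le_min ?_ ?_
  · nlinarith [Real.sin_sq_le_one (π * h)]
  · have h1 : Real.sin (π * h) ^ 2 ≤ (π * h) ^ 2 := sq_le_sq.2 Real.abs_sin_le_abs
    nlinarith

theorem gagliardoConst_pos {s : ℝ} (hs0 : 0 < s) (hs : s < 1) : 0 < gagliardoConst s := by
  rw [gagliardoConst, setIntegral_pos_iff_support_of_nonneg_ae
    ((ae_restrict_iff' measurableSet_Ioi).2 (.of_forall fun h hh => by
      have h0 : 0 < h := hh
      positivity)) (integrableOn_sin_sq_mul_rpow hs0 hs)]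
  have hsub : Set.Ioo (0 : ℝ) 1 ⊆ Function.support
      (fun h : ℝ => (2 * Real.sin (π * h)) ^ 2 * h ^ (-1 - 2 * s)) ∩ Set.Ioi 0 := by
    rintro h ⟨h0, h1⟩
    refine ⟨?_, h0⟩
    have : 0 < Real.sin (π * h) :=
      Real.sin_pos_of_pos_of_lt_pi (by positivity) (by nlinarith [Real.pi_pos])
    have : 0 < (2 * Real.sin (π * h)) ^ 2 * h ^ (-1 - 2 * s) := by positivity
    exact this.ne'
  refine lt_of_lt_of_le ?_ (measure_mono hsub)
  simp

theorem sin_sq_mul_rpow_eq {s ξ h : ℝ} (hξ : ξ ≠ 0) (hh : 0 < h) :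
    (2 * Real.sin (π * (h * ξ))) ^ 2 * h ^ (-1 - 2 * s) =
      |ξ| ^ (1 + 2 * s) *
        ((2 * Real.sin (π * (|ξ| * h))) ^ 2 * (|ξ| * h) ^ (-1 - 2 * s)) := by
  have ha : 0 < |ξ| := abs_pos.2 hξ
  have hsin : Real.sin (π * (|ξ| * h)) ^ 2 = Real.sin (π * (h * ξ)) ^ 2 := by
    rcases abs_choice ξ with h' | h' <;> rw [h']
    · rw [mul_comm ξ]
    · rw [neg_mul, mul_neg, Real.sin_neg, neg_sq, mul_comm ξ]
  have hpow : |ξ| ^ (1 + 2 * s) * |ξ| ^ (-1 - 2 * s) = 1 := by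
    rw [← Real.rpow_add ha]
    ring_nf
    simp
  rw [Real.mul_rpow ha.le hh.le, mul_pow, mul_pow, hsin]
  linear_combination (-(2 ^ 2 * Real.sin (π * (h * ξ)) ^ 2 * h ^ (-1 - 2 * s))) * hpow

theorem integrableOn_sin_sq_mul_rpow_comp {s : ℝ} (hs0 : 0 < s) (hs : s < 1) (ξ : ℝ) :
    IntegrableOn (fun h : ℝ => (2 * Real.sin (π * (h * ξ))) ^ 2 * h ^ (-1 - 2 * s))
      (Set.Ioi 0) := by
  rcases eq_or_ne ξ 0 with rfl | hξ
  · simp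
  refine IntegrableOn.congr_fun (Integrable.const_mul ?_ (|ξ| ^ (1 + 2 * s)))
    (fun h hh => (sin_sq_mul_rpow_eq hξ hh).symm) measurableSet_Ioi
  have := (integrableOn_Ioi_comp_mul_left_iff
    (fun h : ℝ => (2 * Real.sin (π * h)) ^ 2 * h ^ (-1 - 2 * s)) 0 (abs_pos.2 hξ)).2
  rw [mul_zero] at this
  exact this (integrableOn_sin_sq_mul_rpow hs0 hs)

theorem integral_sin_sq_mul_rpow {s : ℝ} (hs0 : 0 < s) (ξ : ℝ) :
    ∫ h in Set.Ioi (0 : ℝ), (2 * Real.sin (π * (h * ξ))) ^ 2 * h ^ (-1 - 2 * s) =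
      gagliardoConst s * |ξ| ^ (2 * s) := by
  rcases eq_or_ne ξ 0 with rfl | hξ
  · simp [Real.zero_rpow (by positivity : 2 * s ≠ 0)]
  have ha : 0 < |ξ| := abs_pos.2 hξ
  rw [setIntegral_congr_fun measurableSet_Ioi fun h hh => sin_sq_mul_rpow_eq hξ hh,
    integral_const_mul, integral_comp_mul_left_Ioi
      (fun h : ℝ => (2 * Real.sin (π * h)) ^ 2 * h ^ (-1 - 2 * s)) 0 ha, mul_zero,
    ← gagliardoConst, Real.rpow_add ha, Real.rpow_one, smul_eq_mul]
  field_simp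

/-- The squared `L²` norm of the difference `u(· + h) - u`. -/
def diffNormSq (h : ℝ) (u : 𝓢(ℝ, ℂ)) : ℝ := ∫ x, ‖u (x + h) - u x‖ ^ 2

theorem fourier_compSubConstCLM (u : 𝓢(ℝ, ℂ)) (a ξ : ℝ) :
    𝓕 (u.compSubConstCLM ℂ a) ξ = Complex.exp (Complex.I * ↑(-(2 * π * (a * ξ)))) * 𝓕 u ξ := by
  have h := congrFun (VectorFourier.fourierIntegral_comp_add_right 𝐞 volume (innerₗ ℝ) u (-a)) ξ
  rw [SchwartzMap.fourier_coe, SchwartzMap.fourier_coe]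
  refine Eq.trans ?_ (h.trans ?_)
  · rfl
  · rw [Circle.smul_def, Real.fourierChar_apply, smul_eq_mul]
    congr 2
    simp [mul_comm, mul_left_comm]

theorem integrable_diff_norm_sq (h : ℝ) (u : 𝓢(ℝ, ℂ)) :
    Integrable fun x => ‖u (x + h) - u x‖ ^ 2 := by
  simpa using integrable_norm_sq (u.compSubConstCLM ℂ (-h) - u)

theorem diffNormSq_eq_integral_fourier (h : ℝ) (u : 𝓢(ℝ, ℂ)) :
    diffNormSq h u = ∫ ξ, (2 * Real.sin (π * (h * ξ))) ^ 2 * ‖𝓕 u ξ‖ ^ 2 := by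
  have h1 := SchwartzMap.integral_norm_sq_fourier (u.compSubConstCLM ℂ (-h) - u)
  have h2 : diffNormSq h u = ∫ x, ‖(u.compSubConstCLM ℂ (-h) - u) x‖ ^ 2 := by
    simp [diffNormSq]
  rw [h2, ← h1]
  congr 1
  ext ξ
  have h3 : 𝓕 (u.compSubConstCLM ℂ (-h) - u) ξ =
      (Complex.exp (Complex.I * ↑(2 * π * (h * ξ))) - 1) * 𝓕 u ξ := by
    rw [sub_eq_add_neg, FourierTransform.fourier_add, FourierTransform.fourier_neg,
      add_apply, neg_apply, fourier_compSubConstCLM]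
    ring_nf
  rw [h3, norm_mul, mul_pow, Complex.norm_exp_I_mul_ofReal_sub_one, Real.norm_eq_abs, sq_abs]
  ring_nf

theorem integrable_gagliardo_kernel {s : ℝ} (hs0 : 0 < s) (hs : s < 1) (u : 𝓢(ℝ, ℂ)) :
    Integrable (Function.uncurry fun h ξ : ℝ =>
        (2 * Real.sin (π * (h * ξ))) ^ 2 * h ^ (-1 - 2 * s) * ‖𝓕 u ξ‖ ^ 2)
      ((volume.restrict (Set.Ioi 0)).prod volume) := by
  have hmeas : Measurable (Function.uncurry fun h ξ : ℝ =>
        (2 * Real.sin (π * (h * ξ))) ^ 2 * h ^ (-1 - 2 * s) * ‖𝓕 u ξ‖ ^ 2) := by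
    have := (𝓕 u).continuous.measurable
    unfold Function.uncurry
    fun_prop
  refine (integrable_prod_iff' hmeas.aestronglyMeasurable).2 ⟨.of_forall fun ξ =>
    (integrableOn_sin_sq_mul_rpow_comp hs0 hs ξ).mul_const (‖𝓕 u ξ‖ ^ 2), ?_⟩
  refine ((integrable_abs_rpow_mul_norm_sq (r := 2 * s) (by positivity) (𝓕 u)).const_mul
    (gagliardoConst s)).congr (.of_forall fun ξ => ?_)
  simp only [Function.uncurry]
  rw [← mul_assoc, ← integral_sin_sq_mul_rpow hs0, ← integral_mul_const]
  refine setIntegral_congr_fun measurableSet_Ioi fun h hh => ?_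
  have h0 : 0 < h := hh
  exact (Real.norm_of_nonneg (by positivity)).symm

theorem rpow_mul_diffNormSq_eq (s h : ℝ) (u : 𝓢(ℝ, ℂ)) :
    h ^ (-1 - 2 * s) * diffNormSq h u =
      ∫ ξ, (2 * Real.sin (π * (h * ξ))) ^ 2 * h ^ (-1 - 2 * s) * ‖𝓕 u ξ‖ ^ 2 := by
  rw [diffNormSq_eq_integral_fourier, ← integral_const_mul]
  congr 1
  ext ξ
  ring

theorem integrableOn_rpow_mul_diffNormSq {s : ℝ} (hs0 : 0 < s) (hs : s < 1) (u : 𝓢(ℝ, ℂ)) :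
    IntegrableOn (fun h => h ^ (-1 - 2 * s) * diffNormSq h u) (Set.Ioi 0) := by
  simp_rw [rpow_mul_diffNormSq_eq]
  exact (integrable_gagliardo_kernel hs0 hs u).integral_prod_left

theorem integral_rpow_mul_diffNormSq {s : ℝ} (hs0 : 0 < s) (hs : s < 1) (u : 𝓢(ℝ, ℂ)) :
    ∫ h in Set.Ioi (0 : ℝ), h ^ (-1 - 2 * s) * diffNormSq h u =
      gagliardoConst s * ∫ ξ, |ξ| ^ (2 * s) * ‖𝓕 u ξ‖ ^ 2 := by
  simp_rw [rpow_mul_diffNormSq_eq]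
  rw [integral_integral_swap (integrable_gagliardo_kernel hs0 hs u), ← integral_const_mul]
  congr 1
  ext ξ
  rw [integral_mul_const, integral_sin_sq_mul_rpow hs0, mul_assoc]

/-! ### Multiplication by bounded Lipschitz functions on fractional Sobolev spaces -/

theorem diffNormSq_mul_le {b : ℝ → ℝ} (hb : ∀ x, |b x| ≤ 1)
    (hlip : ∀ x y, |b x - b y| ≤ 2 * |x - y|) {u w : 𝓢(ℝ, ℂ)} (huw : ∀ x, u x = b x * w x)
    (h : ℝ) :
    diffNormSq h u ≤ 2 * diffNormSq h w + 2 * (min 4 (4 * h ^ 2) * ∫ x, ‖w x‖ ^ 2) := by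
  have hI1 := (integrable_diff_norm_sq h w).const_mul 2
  have hI2 := ((integrable_norm_sq w).const_mul (min 4 (4 * h ^ 2))).const_mul 2
  rw [diffNormSq, diffNormSq, ← integral_const_mul, ← integral_const_mul, ← integral_const_mul,
    ← integral_add hI1 hI2]
  refine integral_mono (integrable_diff_norm_sq h u) (hI1.add hI2) fun x => ?_
  have hβ : |b (x + h) - b x| ^ 2 ≤ min 4 (4 * h ^ 2) := by
    refine le_min ?_ ?_
    · have : |b (x + h) - b x| ≤ 2 := by
        linarith [abs_sub (b (x + h)) (b x), hb (x + h), hb x]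
      nlinarith [abs_nonneg (b (x + h) - b x)]
    · have : |b (x + h) - b x| ≤ 2 * |h| := by simpa using hlip (x + h) x
      calc |b (x + h) - b x| ^ 2 ≤ (2 * |h|) ^ 2 := by gcongr
        _ = 4 * h ^ 2 := by rw [mul_pow, sq_abs]; norm_num
  have hsplit : u (x + h) - u x =
      b (x + h) * (w (x + h) - w x) + ((b (x + h) - b x : ℝ) : ℂ) * w x := by
    rw [huw, huw]
    push_cast
    ring
  have hnorm : ‖u (x + h) - u x‖ ≤ ‖w (x + h) - w x‖ + |b (x + h) - b x| * ‖w x‖ := by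
    rw [hsplit]
    refine (norm_add_le _ _).trans ?_
    rw [norm_mul, norm_mul, Complex.norm_real, Complex.norm_real, Real.norm_eq_abs,
      Real.norm_eq_abs]
    gcongr
    exact mul_le_of_le_one_left (norm_nonneg _) (hb _)
  calc ‖u (x + h) - u x‖ ^ 2
      ≤ (‖w (x + h) - w x‖ + |b (x + h) - b x| * ‖w x‖) ^ 2 := by gcongr
    _ ≤ 2 * (‖w (x + h) - w x‖ ^ 2 + (|b (x + h) - b x| * ‖w x‖) ^ 2) := add_sq_le
    _ = 2 * ‖w (x + h) - w x‖ ^ 2 + 2 * (|b (x + h) - b x| ^ 2 * ‖w x‖ ^ 2) := by ring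
    _ ≤ 2 * ‖w (x + h) - w x‖ ^ 2 + 2 * (min 4 (4 * h ^ 2) * ‖w x‖ ^ 2) := by gcongr

/-- Multiplication by a bounded Lipschitz function is bounded on `H^s`, for Schwartz inputs and
outputs and `0 < s ≤ 1/2`. -/
theorem exists_integral_jap_rpow_mul_le {s : ℝ} (hs0 : 0 < s) (hs : s ≤ 1 / 2) :
    ∃ C : ℝ, 0 < C ∧ ∀ b : ℝ → ℝ, (∀ x, |b x| ≤ 1) → (∀ x y, |b x - b y| ≤ 2 * |x - y|) →
      ∀ u w : 𝓢(ℝ, ℂ), (∀ x, u x = b x * w x) →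
        ∫ ξ, jap ξ ^ (2 * s) * ‖𝓕 u ξ‖ ^ 2 ≤ C * ∫ ξ, jap ξ ^ (2 * s) * ‖𝓕 w ξ‖ ^ 2 := by
  have hs1 : s < 1 := by linarith
  have h2s : 0 ≤ 2 * s := by linarith
  set K := gagliardoConst s with hK
  have hKpos : 0 < K := gagliardoConst_pos hs0 hs1
  set M := ∫ h in Set.Ioi (0 : ℝ), min 4 (4 * h ^ 2) * h ^ (-1 - 2 * s) with hM
  have hMint := integrableOn_min_mul_rpow hs0 hs1 4 (by norm_num)
  have hM0 : 0 ≤ M := setIntegral_nonneg measurableSet_Ioi fun h hh => by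
    have h0 : 0 < h := hh
    positivity
  refine ⟨3 + 2 * M / K, by positivity, fun b hb hlip u w huw => ?_⟩
  set L := ∫ x, ‖w x‖ ^ 2 with hL
  set D := fun v : 𝓢(ℝ, ℂ) => ∫ ξ, |ξ| ^ (2 * s) * ‖𝓕 v ξ‖ ^ 2 with hD
  set J := ∫ ξ, jap ξ ^ (2 * s) * ‖𝓕 w ξ‖ ^ 2 with hJ
  have hDuw : K * D u ≤ 2 * (K * D w) + 2 * (M * L) := by
    have hI1 := (integrableOn_rpow_mul_diffNormSq hs0 hs1 w).const_mul 2
    have hI2 := (hMint.mul_const L).const_mul 2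
    simp only [hD, hK, hM]
    rw [← integral_rpow_mul_diffNormSq hs0 hs1, ← integral_rpow_mul_diffNormSq hs0 hs1,
      ← integral_const_mul, ← integral_mul_const, ← integral_const_mul, ← integral_add hI1 hI2]
    refine setIntegral_mono_on (integrableOn_rpow_mul_diffNormSq hs0 hs1 u) (hI1.add hI2)
      measurableSet_Ioi fun h hh => ?_
    have h0 : 0 < h := hh
    calc h ^ (-1 - 2 * s) * diffNormSq h u
        ≤ h ^ (-1 - 2 * s) * (2 * diffNormSq h w + 2 * (min 4 (4 * h ^ 2) * L)) := by
          gcongr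
          exact diffNormSq_mul_le hb hlip huw h
      _ = _ := by ring
  have hLu : ∫ ξ, ‖𝓕 u ξ‖ ^ 2 ≤ L := by
    rw [SchwartzMap.integral_norm_sq_fourier]
    refine integral_mono (integrable_norm_sq u) (integrable_norm_sq w) fun x => ?_
    have : ‖u x‖ ≤ ‖w x‖ := by
      rw [huw, norm_mul, Complex.norm_real, Real.norm_eq_abs]
      exact mul_le_of_le_one_left (norm_nonneg _) (hb x)
    exact pow_le_pow_left₀ (norm_nonneg _) this 2
  have hLJ : L ≤ J := by
    rw [hL, ← SchwartzMap.integral_norm_sq_fourier]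
    refine integral_mono (integrable_norm_sq _) (integrable_jap_rpow_mul_norm_sq _ _) fun ξ => ?_
    exact le_mul_of_one_le_left (by positivity) (one_le_jap_rpow h2s ξ)
  have hDJ : D w ≤ J :=
    integral_mono (integrable_abs_rpow_mul_norm_sq h2s _) (integrable_jap_rpow_mul_norm_sq _ _)
      fun ξ => mul_le_mul_of_nonneg_right (abs_rpow_le_jap_rpow h2s ξ) (by positivity)
  have hDu : D u ≤ 2 * D w + 2 * M / K * L := by
    refine le_of_mul_le_mul_left (hDuw.trans_eq ?_) hKpos
    field_simp
  calc ∫ ξ, jap ξ ^ (2 * s) * ‖𝓕 u ξ‖ ^ 2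
      ≤ ∫ ξ, (‖𝓕 u ξ‖ ^ 2 + |ξ| ^ (2 * s) * ‖𝓕 u ξ‖ ^ 2) := by
        refine integral_mono (integrable_jap_rpow_mul_norm_sq _ _)
          ((integrable_norm_sq _).add (integrable_abs_rpow_mul_norm_sq h2s _)) fun ξ => ?_
        have := mul_le_mul_of_nonneg_right
          (jap_rpow_le_one_add_abs_rpow h2s (by linarith) ξ) (sq_nonneg ‖𝓕 u ξ‖)
        simpa [add_mul] using this
    _ = (∫ ξ, ‖𝓕 u ξ‖ ^ 2) + D u :=
        integral_add (integrable_norm_sq _) (integrable_abs_rpow_mul_norm_sq h2s _)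
    _ ≤ J + (2 * J + 2 * M / K * J) := by
        refine add_le_add (hLu.trans hLJ) (hDu.trans ?_)
        gcongr
    _ = (3 + 2 * M / K) * J := by ring

/-! ### Fourier multipliers and Sobolev norms on Schwartz functions -/

theorem FT_eq_fourier (u : 𝓢(ℝ, ℂ)) : FT u = 𝓕 u := by
  ext ξ
  rw [SchwartzMap.fourier_coe, Real.fourier_eq', FT]
  congr 1
  ext v
  rw [smul_eq_mul]
  congr 2
  simp
  ring

theorem IFT_eq_fourierInv (u : 𝓢(ℝ, ℂ)) : IFT u = 𝓕⁻ u := by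
  ext ξ
  rw [SchwartzMap.fourierInv_coe, Real.fourierInv_eq', IFT]
  congr 1
  ext v
  rw [smul_eq_mul]
  congr 2
  simp
  ring

theorem mult_eq_fourierInv {a : ℝ → ℝ} (ha : a.HasTemperateGrowth) (u : 𝓢(ℝ, ℂ)) :
    mult a u = 𝓕⁻ (SchwartzMap.smulLeftCLM ℂ a (𝓕 u)) := by
  rw [mult, ← IFT_eq_fourierInv, FT_eq_fourier]
  congr 1
  ext ξ
  rw [SchwartzMap.smulLeftCLM_apply_apply ha, Complex.real_smul]

theorem HsNorm_sq (s : ℝ) (u : 𝓢(ℝ, ℂ)) :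
    HsNorm s u ^ 2 = ∫ ξ, jap ξ ^ (2 * s) * ‖𝓕 u ξ‖ ^ 2 := by
  have h0 : 0 ≤ ∫ ξ, jap ξ ^ (2 * s) * ‖𝓕 u ξ‖ ^ 2 := integral_nonneg fun ξ =>
    mul_nonneg (Real.rpow_nonneg (jap_pos ξ).le _) (sq_nonneg _)
  rw [HsNorm, FT_eq_fourier, ← Real.sqrt_eq_rpow, Real.sq_sqrt h0]

theorem norm_L2inner_le (u w : 𝓢(ℝ, ℂ)) :
    ‖L2inner u w‖ ≤ ∫ ξ, ‖𝓕 u ξ‖ * ‖𝓕 w ξ‖ := by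
  have h : L2inner u w = ∫ ξ, inner ℂ (𝓕 w ξ) (𝓕 u ξ) := by
    rw [SchwartzMap.integral_inner_fourier_fourier]
    rfl
  rw [h]
  refine (norm_integral_le_integral_norm _).trans_eq ?_
  congr 1
  ext ξ
  rw [RCLike.inner_apply, norm_mul, RCLike.norm_conj]

/-- Multiplication of a Schwartz function by the identity function. -/
def mulId (u : 𝓢(ℝ, ℂ)) : 𝓢(ℝ, ℂ) := SchwartzMap.smulLeftCLM ℂ (fun x : ℝ => x) u

theorem mulId_apply (u : 𝓢(ℝ, ℂ)) (x : ℝ) : mulId u x = x * u x := by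
  rw [mulId, SchwartzMap.smulLeftCLM_apply_apply (by fun_prop), Complex.real_smul]

theorem norm_deriv_fourier (u : 𝓢(ℝ, ℂ)) (ξ : ℝ) :
    ‖deriv (𝓕 u : 𝓢(ℝ, ℂ)) ξ‖ = 2 * π * ‖𝓕 (mulId u) ξ‖ := by
  have h := DFunLike.congr_fun (SchwartzMap.lineDerivOp_fourier_eq u (1 : ℝ)) ξ
  have h1 : SchwartzMap.smulLeftCLM ℂ (fun x : ℝ => inner ℝ x 1) u = mulId u := by
    rw [mulId]
    congr 2
    ext x
    simp
  rw [h1, FourierTransform.fourier_smul, smul_apply,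
    SchwartzMap.lineDerivOp_apply_eq_fderiv, fderiv_apply_one_eq_deriv] at h
  rw [h]
  simp [abs_of_pos Real.pi_pos]

/-- The pointwise Fourier-side bound behind the weighted estimate: commuting the weight `v` past
the multiplier `p` costs one derivative of `p`. -/
theorem norm_fourier_mulId_le {p : ℝ → ℝ} (hp : Differentiable ℝ p) {u w : 𝓢(ℝ, ℂ)}
    (huw : ∀ ξ, 𝓕 u ξ = p ξ * 𝓕 w ξ) (ξ : ℝ) :
    ‖𝓕 (mulId u) ξ‖ ≤ |p ξ| * ‖𝓕 (mulId w) ξ‖ + |deriv p ξ| * ‖𝓕 w ξ‖ := by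
  have hd : deriv (𝓕 u : 𝓢(ℝ, ℂ)) ξ =
      deriv p ξ * 𝓕 w ξ + p ξ * deriv (𝓕 w : 𝓢(ℝ, ℂ)) ξ := by
    have h := (hp ξ).hasDerivAt.ofReal_comp.mul ((𝓕 w).hasDerivAt ξ)
    rw [show ⇑(𝓕 u : 𝓢(ℝ, ℂ)) = fun ξ => (p ξ : ℂ) * 𝓕 w ξ from funext huw]
    exact h.deriv
  have hpi : 1 ≤ 2 * π := by linarith [Real.pi_gt_three]
  have h1 : 2 * π * ‖𝓕 (mulId u) ξ‖ ≤
      |deriv p ξ| * ‖𝓕 w ξ‖ + |p ξ| * (2 * π * ‖𝓕 (mulId w) ξ‖) := by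
    rw [← norm_deriv_fourier, ← norm_deriv_fourier, hd]
    refine (norm_add_le _ _).trans_eq ?_
    rw [norm_mul, norm_mul, Complex.norm_real, Complex.norm_real, Real.norm_eq_abs,
      Real.norm_eq_abs]
  refine le_of_mul_le_mul_left (h1.trans ?_) (by positivity : 0 < 2 * π)
  have h2 : |deriv p ξ| * ‖𝓕 w ξ‖ ≤ 2 * π * (|deriv p ξ| * ‖𝓕 w ξ‖) :=
    le_mul_of_one_le_left (by positivity) hpi
  linarith

theorem norm_L2inner_multiplier_le {p : ℝ → ℝ} {A r : ℝ} (hp : ∀ ξ, |p ξ| ≤ A * jap ξ ^ r)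
    {u w : 𝓢(ℝ, ℂ)} (huw : ∀ ξ, 𝓕 u ξ = p ξ * 𝓕 w ξ) :
    ‖L2inner u w‖ ≤ A * ∫ ξ, jap ξ ^ r * ‖𝓕 w ξ‖ ^ 2 := by
  rw [← integral_const_mul]
  refine (norm_L2inner_le u w).trans (integral_mono (integrable_norm_mul_norm _ _)
    ((integrable_jap_rpow_mul_norm_sq r _).const_mul A) fun ξ => ?_)
  calc ‖𝓕 u ξ‖ * ‖𝓕 w ξ‖ = |p ξ| * ‖𝓕 w ξ‖ ^ 2 := by
        rw [huw, norm_mul, Complex.norm_real, Real.norm_eq_abs]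
        ring
    _ ≤ A * jap ξ ^ r * ‖𝓕 w ξ‖ ^ 2 := mul_le_mul_of_nonneg_right (hp ξ) (sq_nonneg _)
    _ = A * (jap ξ ^ r * ‖𝓕 w ξ‖ ^ 2) := by ring

theorem norm_L2inner_mulId_multiplier_le {p : ℝ → ℝ} (hpd : Differentiable ℝ p) {A B r : ℝ}
    (hp : ∀ ξ, |p ξ| ≤ A * jap ξ ^ r) (hB : 0 ≤ B) (hp' : ∀ ξ, |deriv p ξ| ≤ B * jap ξ ^ r)
    {u w : 𝓢(ℝ, ℂ)} (huw : ∀ ξ, 𝓕 u ξ = p ξ * 𝓕 w ξ) :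
    ‖L2inner (mulId u) (mulId w)‖ ≤
      (A + B) * (∫ ξ, jap ξ ^ r * ‖𝓕 (mulId w) ξ‖ ^ 2) +
        B * ∫ ξ, jap ξ ^ r * ‖𝓕 w ξ‖ ^ 2 := by
  have hI1 := (integrable_jap_rpow_mul_norm_sq r (𝓕 (mulId w))).const_mul (A + B)
  have hI2 := (integrable_jap_rpow_mul_norm_sq r (𝓕 w)).const_mul B
  rw [← integral_const_mul, ← integral_const_mul, ← integral_add hI1 hI2]
  refine (norm_L2inner_le _ _).trans
    (integral_mono (integrable_norm_mul_norm _ _) (hI1.add hI2) fun ξ => ?_)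
  have hj : 0 ≤ jap ξ ^ r := Real.rpow_nonneg (jap_pos ξ).le _
  set X := ‖𝓕 (mulId w) ξ‖ with hX
  set Y := ‖𝓕 w ξ‖ with hY
  have hX0 : 0 ≤ X := norm_nonneg _
  have hY0 : 0 ≤ Y := norm_nonneg _
  calc ‖𝓕 (mulId u) ξ‖ * X
      ≤ (A * jap ξ ^ r * X + B * jap ξ ^ r * Y) * X := by
        refine mul_le_mul_of_nonneg_right ((norm_fourier_mulId_le hpd huw ξ).trans ?_) hX0
        exact add_le_add (mul_le_mul_of_nonneg_right (hp ξ) hX0)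
          (mul_le_mul_of_nonneg_right (hp' ξ) hY0)
    _ = A * (jap ξ ^ r * X ^ 2) + B * jap ξ ^ r * (X * Y) := by ring
    _ ≤ A * (jap ξ ^ r * X ^ 2) + B * jap ξ ^ r * (X ^ 2 + Y ^ 2) := by
        gcongr
        nlinarith [sq_nonneg (X - Y)]
    _ = (A + B) * (jap ξ ^ r * X ^ 2) + B * (jap ξ ^ r * Y ^ 2) := by ring

/-! ### Estimates for the exponential mollifier -/

theorem HswNorm_one_sq (s : ℝ) (u : 𝓢(ℝ, ℂ)) :
    HswNorm s 1 u ^ 2 = ∫ ξ, jap ξ ^ (2 * s) *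
      ‖𝓕 (SchwartzMap.smulLeftCLM ℂ (fun v => jap v ^ (1 : ℝ)) u) ξ‖ ^ 2 := by
  rw [← HsNorm_sq, HswNorm]
  congr 2
  ext v
  rw [SchwartzMap.smulLeftCLM_apply_apply (hasTemperateGrowth_jap_rpow 1), Complex.real_smul]

/-- The weight `⟨v⟩` controls both the weight `v` and the constant weight in `H^s`. -/
theorem exists_HsNorm_le_HswNorm {s : ℝ} (hs0 : 0 < s) (hs : s ≤ 1 / 2) :
    ∃ C : ℝ, 0 < C ∧ ∀ u : 𝓢(ℝ, ℂ),
      (∫ ξ, jap ξ ^ (2 * s) * ‖𝓕 (mulId u) ξ‖ ^ 2) ≤ C * HswNorm s 1 u ^ 2 ∧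
        (∫ ξ, jap ξ ^ (2 * s) * ‖𝓕 u ξ‖ ^ 2) ≤ C * HswNorm s 1 u ^ 2 := by
  obtain ⟨C, hC, hmul⟩ := exists_integral_jap_rpow_mul_le hs0 hs
  refine ⟨C, hC, fun u => ?_⟩
  have hw (x : ℝ) :
      SchwartzMap.smulLeftCLM ℂ (fun v => jap v ^ (1 : ℝ)) u x = (jap x : ℂ) * u x := by
    rw [SchwartzMap.smulLeftCLM_apply_apply (hasTemperateGrowth_jap_rpow 1), Complex.real_smul,
      Real.rpow_one]
  have hj (x : ℝ) : (jap x : ℂ) ≠ 0 := Complex.ofReal_ne_zero.2 (jap_pos x).ne'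
  rw [HswNorm_one_sq]
  refine ⟨hmul (fun x => x / jap x) abs_div_jap_le_one abs_div_jap_sub_le _ _ fun x => ?_,
    hmul (fun x => (jap x)⁻¹) abs_inv_jap_le_one
      (fun x y => (abs_inv_jap_sub_le x y).trans (by linarith [abs_nonneg (x - y)])) _ _
      fun x => ?_⟩
  · rw [hw, mulId_apply]
    push_cast
    field_simp [hj x]
  · rw [hw]
    push_cast
    field_simp [hj x]

/-- Estimates for the time derivative of the exponential mollifier acting on a
Schwartz function:
`|((∂_tG_δ)(t,D)f, G_δ(t,D)f)_{L²}| ≤ C‖G_δ(t,D)f‖²_{H^{s'}}` and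
`|(v(∂_tG_δ)(t,D)f, vG_δ(t,D)f)_{L²}| ≤ C‖G_δ(t,D)f‖²_{H^{s'}₁}`,
uniformly in `δ ∈ (0,1)` and `t ∈ [0,T]`. -/
theorem Gmol_time_derivative_bounds (c₀ s' T : ℝ) (hc₀ : 0 < c₀) (hs'0 : 0 < s')
    (hs' : s' < 1 / 2) (hT : 0 < T) :
    ∃ C : ℝ, 0 < C ∧ ∀ δ : ℝ, 0 < δ → δ < 1 → ∀ t : ℝ, 0 ≤ t → t ≤ T →
      ∀ f : SchwartzMap ℝ ℝ,
        ‖L2inner (mult (fun ξ => deriv (fun τ : ℝ => Gmol c₀ s' δ τ ξ) t) fun w => (f w : ℂ))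
            (mult (Gmol c₀ s' δ t) fun w => (f w : ℂ))‖
          ≤ C * HsNorm s' (mult (Gmol c₀ s' δ t) fun w => (f w : ℂ)) ^ 2 ∧
        ‖L2inner
            (fun v : ℝ =>
              (v : ℂ) *
                mult (fun ξ => deriv (fun τ : ℝ => Gmol c₀ s' δ τ ξ) t) (fun w => (f w : ℂ)) v)
            (fun v : ℝ => (v : ℂ) * mult (Gmol c₀ s' δ t) (fun w => (f w : ℂ)) v)‖
          ≤ C * HswNorm s' 1 (mult (Gmol c₀ s' δ t) fun w => (f w : ℂ)) ^ 2 := by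
  obtain ⟨K, hK, hweight⟩ := exists_HsNorm_le_HswNorm hs'0 hs'.le
  set B := c₀ * (1 + c₀ * T) with hB
  have hB0 : 0 < B := by positivity
  refine ⟨c₀ + (c₀ + B) * K + B * K, by positivity, fun δ hδ _ t ht0 htT f => ?_⟩
  have hG := hasTemperateGrowth_Gmol hδ c₀ s' t
  have hp := hasTemperateGrowth_logDerivGmol c₀ s' δ t
  set fC : 𝓢(ℝ, ℂ) := f.postcompCLM Complex.ofRealCLM
  have hf : (fun w => (f w : ℂ)) = fC := rfl
  have hdG : (fun ξ => deriv (fun τ : ℝ => Gmol c₀ s' δ τ ξ) t) =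
      logDerivGmol c₀ s' δ t * Gmol c₀ s' δ t := funext fun ξ => deriv_Gmol hδ c₀ s' t ξ
  rw [hf, hdG, mult_eq_fourierInv hG, mult_eq_fourierInv (hp.mul hG)]
  set g : 𝓢(ℝ, ℂ) := 𝓕⁻ (SchwartzMap.smulLeftCLM ℂ (Gmol c₀ s' δ t) (𝓕 fC)) with hg
  set k : 𝓢(ℝ, ℂ) := 𝓕⁻ (SchwartzMap.smulLeftCLM ℂ
    (logDerivGmol c₀ s' δ t * Gmol c₀ s' δ t) (𝓕 fC)) with hk
  have hkg (ξ : ℝ) : 𝓕 k ξ = logDerivGmol c₀ s' δ t ξ * 𝓕 g ξ := by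
    rw [hk, hg, FourierTransform.fourier_fourierInv_eq, FourierTransform.fourier_fourierInv_eq,
      SchwartzMap.smulLeftCLM_apply_apply hG, SchwartzMap.smulLeftCLM_apply_apply (hp.mul hG),
      Complex.real_smul, Complex.real_smul, Pi.mul_apply, Complex.ofReal_mul, mul_assoc]
  have hpA := abs_logDerivGmol_le hc₀ s' δ t
  constructor
  · rw [HsNorm_sq]
    refine (norm_L2inner_multiplier_le hpA hkg).trans ?_
    refine mul_le_mul_of_nonneg_right ?_ (integral_nonneg fun ξ =>
      mul_nonneg (Real.rpow_nonneg (jap_pos ξ).le _) (sq_nonneg _))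
    rw [add_assoc]
    exact le_add_of_nonneg_right (by positivity)
  · have hvk : (fun v : ℝ => (v : ℂ) * k v) = mulId k := funext fun v => (mulId_apply k v).symm
    have hvg : (fun v : ℝ => (v : ℂ) * g v) = mulId g := funext fun v => (mulId_apply g v).symm
    rw [hvk, hvg]
    refine (norm_L2inner_mulId_multiplier_le (hp.1.differentiable (by simp)) hpA hB0.le
      (abs_deriv_logDerivGmol_le hc₀ hs'0 hs' ht0 htT δ) hkg).trans ?_
    obtain ⟨h1, h2⟩ := hweight g
    have h3 := mul_le_mul_of_nonneg_left h1 (by positivity : 0 ≤ c₀ + B)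
    have h4 := mul_le_mul_of_nonneg_left h2 hB0.le
    have h5 : 0 ≤ c₀ * HswNorm s' 1 g ^ 2 := by positivity
    linarith
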